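/- There exist constants α ∈ (0,1) and C > 0, depending only on the data (u_T, m₀, L, T, σ, r, ε), such that every smooth solution (u,m) of the MFG system satisfies: |u|, |u_t|, |u_x|, |u_xx|, |m|, |m_t|, |m_x|, |m_xx| are all bounded by C on [0,T]×[0,L], and for all (t,x), (s,y) ∈ [0,T]×[0,L], |u_t(t,x) − u_t(s,y)| + |u_xx(t,x) − u_xx(s,y)| + |m_t(t,x) − m_t(s,y)| + |m_xx(t,x) − m_xx(s,y)| ≤ C (|t − s|^{α/2} + |x − y|^α). -/

import Mathlib

open Set MeasureTheory intervalIntegral Function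

noncomputable section

/-- Spatial derivative `u_x`. -/
def pdx (u : ℝ → ℝ → ℝ) (t x : ℝ) : ℝ := deriv (u t) x

/-- Second spatial derivative `u_xx`. -/
def pdxx (u : ℝ → ℝ → ℝ) (t x : ℝ) : ℝ := deriv (deriv (u t)) x

/-- Time derivative `u_t`. -/
def pdt (u : ℝ → ℝ → ℝ) (t x : ℝ) : ℝ := deriv (fun s => u s x) t

/-- `η(t) = ∫₀^L m(t,x) dx`. -/
def mfgEta (L : ℝ) (m : ℝ → ℝ → ℝ) (t : ℝ) : ℝ := ∫ x in (0:ℝ)..L, m t x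

/-- `f(t) = a(η(t)) + c(η(t)) p̄(t)`. -/
def mfgF (L ε : ℝ) (u m : ℝ → ℝ → ℝ) (t : ℝ) : ℝ :=
  2 / (2 + ε * mfgEta L m t)
    + (ε / (2 + ε * mfgEta L m t)) * ∫ x in (0:ℝ)..L, pdx u t x * m t x

/-- `G(t,x) = (1/2)(f(t) − u_x(t,x))`. -/
def mfgG (L ε : ℝ) (u m : ℝ → ℝ → ℝ) (t x : ℝ) : ℝ :=
  (1/2) * (mfgF L ε u m t - pdx u t x)

/-- `H(t,x) = G(t,x)²`. -/
def mfgH (L ε : ℝ) (u m : ℝ → ℝ → ℝ) (t x : ℝ) : ℝ := (mfgG L ε u m t x)^2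

/-- Standing assumptions on the data. -/
structure MFGData (T L σ r ε : ℝ) (uT m0 : ℝ → ℝ) : Prop where
  hT : 0 < T
  hL : 0 < L
  hσ : 0 < σ
  hr : 0 < r
  hε : 0 ≤ ε
  uT_smooth : ContDiff ℝ 2 uT
  m0_smooth : ContDiff ℝ 2 m0
  uT_zero : uT 0 = 0
  uT_deriv_L : deriv uT L = 0
  uT_nonneg : ∀ x ∈ Icc (0:ℝ) L, 0 ≤ uT x
  uT_deriv_nonneg : ∀ x ∈ Icc (0:ℝ) L, 0 ≤ deriv uT x
  m0_zero : m0 0 = 0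
  m0_L : m0 L = 0
  m0_deriv_L : deriv m0 L = 0
  m0_nonneg : ∀ x ∈ Icc (0:ℝ) L, 0 ≤ m0 x
  m0_mass : (∫ x in (0:ℝ)..L, m0 x) = 1

/-- A smooth solution of the MFG system \eqref{main system}. -/
structure IsMFGSolution (T L σ r ε : ℝ) (uT m0 : ℝ → ℝ) (u m : ℝ → ℝ → ℝ) : Prop where
  u_smooth : ContDiff ℝ (⊤ : ℕ∞) (uncurry u)
  m_smooth : ContDiff ℝ (⊤ : ℕ∞) (uncurry m)
  hjb : ∀ t ∈ Ioo (0:ℝ) T, ∀ x ∈ Ioo (0:ℝ) L,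
    pdt u t x + σ^2/2 * pdxx u t x - r * u t x + mfgH L ε u m t x = 0
  fp : ∀ t ∈ Ioo (0:ℝ) T, ∀ x ∈ Ioo (0:ℝ) L,
    pdt m t x - σ^2/2 * pdxx m t x
      - deriv (fun y => mfgG L ε u m t y * m t y) x = 0
  m_init : ∀ x ∈ Icc (0:ℝ) L, m 0 x = m0 x
  u_term : ∀ x ∈ Icc (0:ℝ) L, u T x = uT x
  u_bdry : ∀ t ∈ Icc (0:ℝ) T, u t 0 = 0
  m_bdry : ∀ t ∈ Icc (0:ℝ) T, m t 0 = 0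
  ux_bdry : ∀ t ∈ Icc (0:ℝ) T, pdx u t L = 0
  m_flux : ∀ t ∈ Icc (0:ℝ) T,
    σ^2/2 * pdx m t L + mfgG L ε u m t L * m t L = 0

end

section Calculus

variable {u : ℝ → ℝ → ℝ}

theorem contDiff_slice_right (h : ContDiff ℝ (⊤ : ℕ∞) (uncurry u)) (t : ℝ) :
    ContDiff ℝ (⊤ : ℕ∞) (u t) :=
  h.comp (contDiff_prodMk_right t)

theorem contDiff_slice_left (h : ContDiff ℝ (⊤ : ℕ∞) (uncurry u)) (x : ℝ) :
    ContDiff ℝ (⊤ : ℕ∞) (fun s => u s x) :=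
  h.comp (contDiff_prodMk_left x)

theorem hasDerivAt_pdx (h : ContDiff ℝ (⊤ : ℕ∞) (uncurry u)) (t x : ℝ) :
    HasDerivAt (u t) (pdx u t x) x :=
  ((contDiff_slice_right h t).differentiable (by simp)).differentiableAt.hasDerivAt

theorem hasDerivAt_pdt (h : ContDiff ℝ (⊤ : ℕ∞) (uncurry u)) (t x : ℝ) :
    HasDerivAt (fun s => u s x) (pdt u t x) t :=
  ((contDiff_slice_left h x).differentiable (by simp)).differentiableAt.hasDerivAt

theorem contDiff_pdx (h : ContDiff ℝ (⊤ : ℕ∞) (uncurry u)) :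
    ContDiff ℝ (⊤ : ℕ∞) (uncurry (pdx u)) := by
  have key : uncurry (pdx u) = fun p => fderiv ℝ (uncurry u) p (0, 1) := by
    ext ⟨t, x⟩
    have h1 : HasFDerivAt (uncurry u) (fderiv ℝ (uncurry u) (t, x)) (t, x) :=
      (h.differentiable (by simp)).differentiableAt.hasFDerivAt
    exact (h1.comp_hasDerivAt x ((hasDerivAt_const x t).prodMk (hasDerivAt_id x))).deriv
  rw [key]
  exact (h.fderiv_right (m := (⊤ : ℕ∞)) (by simp)).clm_apply contDiff_const

theorem contDiff_pdt (h : ContDiff ℝ (⊤ : ℕ∞) (uncurry u)) :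
    ContDiff ℝ (⊤ : ℕ∞) (uncurry (pdt u)) := by
  have key : uncurry (pdt u) = fun p => fderiv ℝ (uncurry u) p (1, 0) := by
    ext ⟨t, x⟩
    have h1 : HasFDerivAt (uncurry u) (fderiv ℝ (uncurry u) (t, x)) (t, x) :=
      (h.differentiable (by simp)).differentiableAt.hasFDerivAt
    exact (h1.comp_hasDerivAt t ((hasDerivAt_id t).prodMk (hasDerivAt_const t x))).deriv
  rw [key]
  exact (h.fderiv_right (m := (⊤ : ℕ∞)) (by simp)).clm_apply contDiff_const

theorem contDiff_pdxx (h : ContDiff ℝ (⊤ : ℕ∞) (uncurry u)) :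
    ContDiff ℝ (⊤ : ℕ∞) (uncurry (pdxx u)) :=
  contDiff_pdx (contDiff_pdx h)

theorem hasDerivAt_pdxx (h : ContDiff ℝ (⊤ : ℕ∞) (uncurry u)) (t x : ℝ) :
    HasDerivAt (pdx u t) (pdxx u t x) x :=
  hasDerivAt_pdx (contDiff_pdx h) t x

theorem continuous_slice (h : ContDiff ℝ (⊤ : ℕ∞) (uncurry u)) (t : ℝ) : Continuous (u t) :=
  (contDiff_slice_right h t).continuous

/-- Differentiation under the integral sign on a compact interval. -/
theorem hasDerivAt_intervalIntegral_param {F F' : ℝ → ℝ → ℝ} (a b : ℝ)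
    (hF : ∀ t, Continuous (F t)) (hF' : Continuous (uncurry F'))
    (h : ∀ t x, HasDerivAt (fun s => F s x) (F' t x) t) (t : ℝ) :
    HasDerivAt (fun s => ∫ x in a..b, F s x) (∫ x in a..b, F' t x) t := by
  obtain ⟨B, hB⟩ := ((isCompact_closedBall t 1).prod (isCompact_uIcc (a := a) (b := b))
    ).exists_bound_of_continuousOn hF'.continuousOn
  refine (hasDerivAt_integral_of_dominated_loc_of_deriv_le (bound := fun _ => B)
    (Metric.closedBall_mem_nhds t one_pos) (Filter.Eventually.of_forall fun s => ?_)
    ((hF t).intervalIntegrable a b) ?_ ?_ (by simp) ?_).2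
  · exact (hF s).aestronglyMeasurable
  · exact (hF'.comp (Continuous.prodMk_right t)).aestronglyMeasurable
  · exact Filter.Eventually.of_forall fun x hx s hs => hB (s, x) ⟨hs, uIoc_subset_uIcc hx⟩
  · exact Filter.Eventually.of_forall fun x _ s _ => h s x

/-- Grönwall's inequality for a nonnegative function vanishing at the initial time. -/
theorem eqOn_zero_of_deriv_le_mul {W W' : ℝ → ℝ} {T K : ℝ}
    (hW : ∀ t, HasDerivAt W (W' t) t) (hnn : ∀ t, 0 ≤ W t) (h0 : W 0 = 0)
    (hle : ∀ t ∈ Ioo 0 T, W' t ≤ K * W t) : ∀ t ∈ Icc 0 T, W t = 0 := by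
  intro t ht
  have hd : ∀ s, HasDerivAt (fun s => Real.exp (-K * s) * W s)
      (Real.exp (-K * s) * (W' s - K * W s)) s := fun s => by
    have h1 : HasDerivAt (fun s => Real.exp (-K * s)) (Real.exp (-K * s) * (-K * 1)) s :=
      ((hasDerivAt_id s).const_mul (-K)).exp
    exact (h1.mul (hW s)).congr_deriv (by ring)
  have hanti := antitoneOn_of_deriv_nonpos (convex_Icc 0 T)
    (f := fun s => Real.exp (-K * s) * W s)
    (fun s _ => (hd s).continuousAt.continuousWithinAt)
    (fun s _ => (hd s).differentiableAt.differentiableWithinAt)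
    (fun s hs => by
      rw [interior_Icc] at hs
      rw [(hd s).deriv]
      exact mul_nonpos_of_nonneg_of_nonpos (Real.exp_pos _).le (by linarith [hle s hs]))
  have h1 := hanti ⟨le_rfl, ht.1.trans ht.2⟩ ht ht.1
  simp only [h0, mul_zero] at h1
  exact le_antisymm (nonpos_of_mul_nonpos_right h1 (Real.exp_pos _)) (hnn t)

/-- Backward Grönwall inequality for a nonnegative function vanishing at the final time. -/
theorem eqOn_zero_of_neg_mul_le_deriv {W W' : ℝ → ℝ} {T K : ℝ}
    (hW : ∀ t, HasDerivAt W (W' t) t) (hnn : ∀ t, 0 ≤ W t) (hT : W T = 0)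
    (hle : ∀ t ∈ Ioo 0 T, -(K * W t) ≤ W' t) : ∀ t ∈ Icc 0 T, W t = 0 := by
  intro t ht
  have h := eqOn_zero_of_deriv_le_mul (W := fun s => W (T - s)) (W' := fun s => -W' (T - s))
    (T := T) (K := K)
    (fun s => ((hW (T - s)).comp s ((hasDerivAt_id s).const_sub T)).congr_deriv (by ring))
    (fun s => hnn _) (by simpa using hT)
    (fun s hs => by linarith [hle (T - s) ⟨by linarith [hs.2], by linarith [hs.1]⟩])
    (T - t) ⟨by linarith [ht.2], by linarith [ht.1]⟩
  simpa using h

/-- A continuous nonnegative function with vanishing integral vanishes. -/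
theorem eq_zero_of_intervalIntegral_eq_zero {f : ℝ → ℝ} {L : ℝ} (hL : 0 < L) (hf : Continuous f)
    (hnn : ∀ x, 0 ≤ f x) (h : ∫ x in (0:ℝ)..L, f x = 0) : ∀ x ∈ Icc 0 L, f x = 0 := by
  intro x hx
  by_contra hne
  have := integral_pos hL hf.continuousOn (fun y _ => hnn y)
    ⟨x, hx, lt_of_le_of_ne (hnn x) (Ne.symm hne)⟩
  exact this.ne' h

/-- Continuous functions that agree on an open interval agree on its closure. -/
theorem eq_on_Icc_of_eq_on_Ioo {f g : ℝ → ℝ} {L : ℝ} (hL : 0 < L) (hf : Continuous f)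
    (hg : Continuous g) (h : ∀ x ∈ Ioo 0 L, f x = g x) : ∀ x ∈ Icc 0 L, f x = g x := by
  have := Set.EqOn.closure (s := Ioo 0 L) h hf hg
  rwa [closure_Ioo hL.ne] at this

/-- Smooth powers of the negative part. -/
theorem hasDerivAt_negPart_pow (n : ℕ) (s : ℝ) :
    HasDerivAt (fun s : ℝ => max (-s) 0 ^ (n + 2)) (-(n + 2) * max (-s) 0 ^ (n + 1)) s := by
  have h0 : ∀ s ≠ (0:ℝ),
      HasDerivAt (fun s : ℝ => max (-s) 0 ^ (n + 2)) (-(n + 2) * max (-s) 0 ^ (n + 1)) s := by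
    intro s hs
    rcases lt_or_gt_of_ne hs with h | h
    · have h1 : HasDerivAt (fun s : ℝ => (-s) ^ (n + 2)) (-(n + 2) * (-s) ^ (n + 1)) s :=
        ((hasDerivAt_neg s).pow (n + 2)).congr_deriv (by push_cast; ring)
      rw [max_eq_left (by linarith)]
      refine h1.congr_of_eventuallyEq ?_
      filter_upwards [Iio_mem_nhds h] with y hy
      rw [max_eq_left (by linarith [mem_Iio.1 hy])]
    · rw [max_eq_right (by linarith)]
      refine ((hasDerivAt_const s (0:ℝ)).congr_deriv (by simp)).congr_of_eventuallyEq ?_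
      filter_upwards [Ioi_mem_nhds h] with y hy
      rw [max_eq_right (by linarith [mem_Ioi.1 hy])]
      simp
  by_cases hs : s = 0
  · subst hs
    exact hasDerivAt_of_hasDerivAt_of_ne (g := fun s : ℝ => -(n + 2) * max (-s) 0 ^ (n + 1))
      h0 (by fun_prop) (by fun_prop)
  · exact h0 s hs

end Calculus

namespace IsMFGSolution

variable {T L σ r ε : ℝ} {uT m0 : ℝ → ℝ} {u m : ℝ → ℝ → ℝ}

theorem hasDerivAt_mfgG (h : IsMFGSolution T L σ r ε uT m0 u m) (t x : ℝ) :
    HasDerivAt (mfgG L ε u m t) (-(1/2) * pdxx u t x) x :=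
  (((hasDerivAt_pdxx h.u_smooth t x).const_sub (mfgF L ε u m t)).const_mul (1/2)).congr_deriv
    (by ring)

theorem continuous_mfgG (h : IsMFGSolution T L σ r ε uT m0 u m) (t : ℝ) :
    Continuous (mfgG L ε u m t) :=
  continuous_iff_continuousAt.2 fun x => (h.hasDerivAt_mfgG t x).continuousAt

/-- The HJB equation holds up to the spatial boundary. -/
theorem pdt_u_eq (h : IsMFGSolution T L σ r ε uT m0 u m) (hL : 0 < L) {t : ℝ}
    (ht : t ∈ Ioo 0 T) : ∀ x ∈ Icc 0 L,
      pdt u t x = r * u t x - σ^2/2 * pdxx u t x - mfgG L ε u m t x ^ 2 := by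
  have c1 := continuous_slice (contDiff_pdt h.u_smooth) t
  have c2 := continuous_slice h.u_smooth t
  have c3 := continuous_slice (contDiff_pdxx h.u_smooth) t
  have c4 := h.continuous_mfgG t
  refine eq_on_Icc_of_eq_on_Ioo hL c1 (by fun_prop) fun x hx => ?_
  have := h.hjb t ht x hx
  rw [mfgH] at this
  linarith

/-- The Fokker–Planck equation holds up to the spatial boundary. -/
theorem pdt_m_eq (h : IsMFGSolution T L σ r ε uT m0 u m) (hL : 0 < L) {t : ℝ}
    (ht : t ∈ Ioo 0 T) : ∀ x ∈ Icc 0 L,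
      pdt m t x = σ^2/2 * pdxx m t x
        + (-(1/2) * pdxx u t x * m t x + mfgG L ε u m t x * pdx m t x) := by
  have c1 := continuous_slice (contDiff_pdt h.m_smooth) t
  have c2 := continuous_slice h.m_smooth t
  have c3 := continuous_slice (contDiff_pdxx h.m_smooth) t
  have c4 := h.continuous_mfgG t
  have c5 := continuous_slice (contDiff_pdxx h.u_smooth) t
  have c6 := continuous_slice (contDiff_pdx h.m_smooth) t
  refine eq_on_Icc_of_eq_on_Ioo hL c1 (by fun_prop) fun x hx => ?_
  have h1 := h.fp t ht x hx
  have h2 := ((h.hasDerivAt_mfgG t x).mul (hasDerivAt_pdx h.m_smooth t x)).deriv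
  rw [show (fun y => mfgG L ε u m t y * m t y) = mfgG L ε u m t * m t from rfl, h2] at h1
  linarith

/-- Weak form of the HJB equation. -/
theorem integral_mul_pdt_u (h : IsMFGSolution T L σ r ε uT m0 u m) (hL : 0 < L) {t : ℝ}
    (ht : t ∈ Ioo 0 T) {φ φ' : ℝ → ℝ} (hφ : ∀ x, HasDerivAt φ (φ' x) x) (hφ' : Continuous φ')
    (h0 : φ 0 = 0) :
    ∫ x in (0:ℝ)..L, φ x * pdt u t x =
      ∫ x in (0:ℝ)..L, (σ^2/2 * (φ' x * pdx u t x)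
        + φ x * (r * u t x - mfgG L ε u m t x ^ 2)) := by
  have c0 : Continuous φ := continuous_iff_continuousAt.2 fun x => (hφ x).continuousAt
  have c2 := continuous_slice h.u_smooth t
  have c3 := continuous_slice (contDiff_pdx h.u_smooth) t
  have c4 := h.continuous_mfgG t
  have c5 := continuous_slice (contDiff_pdxx h.u_smooth) t
  have hparts := integral_mul_deriv_eq_deriv_mul (a := 0) (b := L) (fun x _ => hφ x)
    (fun x _ => hasDerivAt_pdxx h.u_smooth t x) (hφ'.intervalIntegrable _ _)
    (c5.intervalIntegrable _ _)
  rw [h.ux_bdry t ⟨ht.1.le, ht.2.le⟩, h0] at hparts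
  have e1 : ∫ x in (0:ℝ)..L, φ x * pdt u t x =
      ∫ x in (0:ℝ)..L, (φ x * (r * u t x - mfgG L ε u m t x ^ 2)
        - σ^2/2 * (φ x * pdxx u t x)) := by
    refine integral_congr fun x hx => ?_
    rw [uIcc_of_le hL.le] at hx
    simp only [h.pdt_u_eq hL ht x hx]
    ring
  rw [e1, intervalIntegral.integral_sub (by apply Continuous.intervalIntegrable; fun_prop)
      (by apply Continuous.intervalIntegrable; fun_prop),
    intervalIntegral.integral_add (by apply Continuous.intervalIntegrable; fun_prop)
      (by apply Continuous.intervalIntegrable; fun_prop),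
    intervalIntegral.integral_const_mul, intervalIntegral.integral_const_mul, hparts]
  ring

/-- Weak form of the Fokker–Planck equation. -/
theorem integral_mul_pdt_m (h : IsMFGSolution T L σ r ε uT m0 u m) (hL : 0 < L) {t : ℝ}
    (ht : t ∈ Ioo 0 T) {φ φ' : ℝ → ℝ} (hφ : ∀ x, HasDerivAt φ (φ' x) x) (hφ' : Continuous φ')
    (h0 : φ 0 = 0) :
    ∫ x in (0:ℝ)..L, φ x * pdt m t x =
      -∫ x in (0:ℝ)..L, φ' x * (σ^2/2 * pdx m t x + mfgG L ε u m t x * m t x) := by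
  have c2 := continuous_slice h.m_smooth t
  have c3 := continuous_slice (contDiff_pdxx h.m_smooth) t
  have c4 := h.continuous_mfgG t
  have c5 := continuous_slice (contDiff_pdxx h.u_smooth) t
  have c6 := continuous_slice (contDiff_pdx h.m_smooth) t
  have hparts := integral_mul_deriv_eq_deriv_mul (a := 0) (b := L) (fun x _ => hφ x)
    (fun x _ => ((hasDerivAt_pdxx h.m_smooth t x).const_mul (σ^2/2)).add
      ((h.hasDerivAt_mfgG t x).mul (hasDerivAt_pdx h.m_smooth t x)))
    (hφ'.intervalIntegrable _ _) (by apply Continuous.intervalIntegrable; fun_prop)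
  simp only [Pi.add_apply, Pi.mul_apply] at hparts
  rw [h.m_flux t ⟨ht.1.le, ht.2.le⟩, h0] at hparts
  have e1 : ∫ x in (0:ℝ)..L, φ x * pdt m t x =
      ∫ x in (0:ℝ)..L, φ x * (σ^2/2 * pdxx m t x
        + (-(1/2) * pdxx u t x * m t x + mfgG L ε u m t x * pdx m t x)) := by
    refine integral_congr fun x hx => ?_
    rw [uIcc_of_le hL.le] at hx
    simp only [h.pdt_m_eq hL ht x hx]
  rw [e1, hparts]
  ring

/-- The HJB equation bounds the optimal control, whatever the nonlocal term is. -/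
theorem exists_mfgG_sq_le (h : IsMFGSolution T L σ r ε uT m0 u m) (hL : 0 < L) :
    ∃ K, ∀ t ∈ Ioo 0 T, ∀ x ∈ Icc 0 L, mfgG L ε u m t x ^ 2 ≤ K := by
  have c1 := (contDiff_pdt h.u_smooth).continuous
  have c2 := h.u_smooth.continuous
  have c3 := (contDiff_pdxx h.u_smooth).continuous
  obtain ⟨K, hK⟩ := ((isCompact_Icc (a := (0:ℝ)) (b := T)).prod
    (isCompact_Icc (a := 0) (b := L))).exists_bound_of_continuousOn
    (f := fun p => r * uncurry u p - σ^2/2 * uncurry (pdxx u) p - uncurry (pdt u) p)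
    (by fun_prop)
  refine ⟨K, fun t ht x hx => ?_⟩
  have h1 := (le_abs_self _).trans (hK (t, x) ⟨⟨ht.1.le, ht.2.le⟩, hx⟩)
  have h2 := h.pdt_u_eq hL ht x hx
  simp only [uncurry] at h1
  linarith

theorem neg_mul_flux_le {σ g K : ℝ} (hσ : 0 < σ) (hg : g ^ 2 ≤ K) (y z : ℝ) :
    -(y * (σ^2/2 * y + g * z)) ≤ K / (2 * σ^2) * z ^ 2 := by
  have h1 : -(y * (σ^2/2 * y + g * z)) = g^2 / (2 * σ^2) * z^2 - (σ * y + g * z / σ)^2 / 2 := by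
    field_simp
    ring
  have h2 : g^2 / (2 * σ^2) * z^2 ≤ K / (2 * σ^2) * z ^ 2 := by gcongr
  nlinarith [sq_nonneg (σ * y + g * z / σ)]

/-- The density stays nonnegative. -/
theorem m_nonneg (h : IsMFGSolution T L σ r ε uT m0 u m) (hdata : MFGData T L σ r ε uT m0) :
    ∀ t ∈ Icc 0 T, ∀ x ∈ Icc 0 L, 0 ≤ m t x := by
  have hL := hdata.hL
  obtain ⟨K, hK⟩ := h.exists_mfgG_sq_le hL
  have cm := h.m_smooth.continuous
  have cmt := (contDiff_pdt h.m_smooth).continuous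
  let W : ℝ → ℝ := fun t => ∫ x in (0:ℝ)..L, max (-m t x) 0 ^ 3
  have hW : ∀ t, HasDerivAt W (∫ x in (0:ℝ)..L, (-3 * max (-m t x) 0 ^ 2) * pdt m t x) t := by
    refine hasDerivAt_intervalIntegral_param (F := fun t x => max (-m t x) 0 ^ 3)
      (F' := fun t x => (-3 * max (-m t x) 0 ^ 2) * pdt m t x) 0 L (fun t => ?_) ?_
      fun t x => ?_
    · have := continuous_slice h.m_smooth t
      fun_prop
    · change Continuous fun p : ℝ × ℝ => (-3 * max (-uncurry m p) 0 ^ 2) * uncurry (pdt m) p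
      fun_prop
    · have := (hasDerivAt_negPart_pow 1 (m t x)).comp t (hasDerivAt_pdt h.m_smooth t x)
      exact this.congr_deriv (by norm_num)
  have hW0 : W 0 = 0 := by
    refine (integral_congr (g := fun _ => 0) fun x hx => ?_).trans (by simp)
    rw [uIcc_of_le hL.le] at hx
    simp only [h.m_init x hx]
    rw [max_eq_right (by linarith [hdata.m0_nonneg x hx])]
    simp
  have hnn : ∀ t x, 0 ≤ max (-m t x) 0 ^ 3 := fun t x => pow_nonneg (le_max_right _ _) 3
  have hz := eqOn_zero_of_deriv_le_mul (T := T) (K := 3 * K / σ^2) hW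
    (fun t => integral_nonneg hL.le fun x _ => hnn t x) hW0 (fun t ht => by
      have c1 := continuous_slice h.m_smooth t
      have c2 := continuous_slice (contDiff_pdx h.m_smooth) t
      have c3 := h.continuous_mfgG t
      rw [h.integral_mul_pdt_m hL ht (φ := fun x => -3 * max (-m t x) 0 ^ 2)
        (φ' := fun x => 6 * max (-m t x) 0 * pdx m t x) (fun x =>
          (((hasDerivAt_negPart_pow 0 (m t x)).comp x
            (hasDerivAt_pdx h.m_smooth t x)).const_mul (-3)).congr_deriv (by norm_num; ring))
        (by fun_prop) (by simp [h.m_bdry t ⟨ht.1.le, ht.2.le⟩]),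
        ← intervalIntegral.integral_neg, ← intervalIntegral.integral_const_mul]
      refine integral_mono_on hL.le (by apply Continuous.intervalIntegrable; fun_prop)
        (by apply Continuous.intervalIntegrable; fun_prop) fun x hx => ?_
      have h1 := neg_mul_flux_le hdata.hσ (hK t ht x hx) (pdx m t x) (m t x)
      have h2 : max (-m t x) 0 * m t x ^ 2 = max (-m t x) 0 ^ 3 := by
        rcases le_total (m t x) 0 with h | h
        · rw [max_eq_left (by linarith)]; ring
        · rw [max_eq_right (by linarith)]; ring
      have h3 : (0:ℝ) ≤ 6 * max (-m t x) 0 := by positivity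
      calc _ = 6 * max (-m t x) 0
            * -(pdx m t x * (σ^2/2 * pdx m t x + mfgG L ε u m t x * m t x)) := by ring
        _ ≤ 6 * max (-m t x) 0 * (K / (2 * σ^2) * m t x ^ 2) := mul_le_mul_of_nonneg_left h1 h3
        _ = 3 * K / σ^2 * (max (-m t x) 0 * m t x ^ 2) := by
          have := hdata.hσ
          field_simp
          ring
        _ = _ := by rw [h2])
  intro t ht x hx
  have c1 := continuous_slice h.m_smooth t
  have h1 := eq_zero_of_intervalIntegral_eq_zero hL (by fun_prop) (hnn t) (hz t ht) x hx
  have h2 := (le_max_left (-m t x) 0).trans (pow_eq_zero_iff (by norm_num) |>.1 h1).le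
  linarith

/-- The nonlocal term is an affine function of the aggregate production. -/
theorem mfgF_eq (h : IsMFGSolution T L σ r ε uT m0 u m) (hdata : MFGData T L σ r ε uT m0) {t : ℝ}
    (ht : t ∈ Icc 0 T) :
    mfgF L ε u m t = 1 - ε * ∫ x in (0:ℝ)..L, mfgG L ε u m t x * m t x := by
  have hη : 0 ≤ mfgEta L m t :=
    integral_nonneg hdata.hL.le fun x hx => h.m_nonneg hdata t ht x hx
  have c1 := continuous_slice h.m_smooth t
  have c2 := continuous_slice (contDiff_pdx h.u_smooth) t
  have hQ : ∫ x in (0:ℝ)..L, mfgG L ε u m t x * m t x =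
      1/2 * mfgF L ε u m t * mfgEta L m t - 1/2 * ∫ x in (0:ℝ)..L, pdx u t x * m t x := by
    rw [mfgEta, ← intervalIntegral.integral_const_mul, ← intervalIntegral.integral_const_mul,
      ← intervalIntegral.integral_sub (by apply Continuous.intervalIntegrable; fun_prop)
        (by apply Continuous.intervalIntegrable; fun_prop)]
    refine integral_congr fun x _ => ?_
    simp only [mfgG]
    ring
  have hne : 2 + ε * mfgEta L m t ≠ 0 := by
    have := mul_nonneg hdata.hε hη
    positivity
  have hF : (2 + ε * mfgEta L m t) * mfgF L ε u m t
      = 2 + ε * ∫ x in (0:ℝ)..L, pdx u t x * m t x := by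
    rw [mfgF]
    field_simp
  rw [hQ]
  linarith

end IsMFGSolution

namespace IsMFGSolution

variable {T L σ r ε : ℝ} {uT m0 : ℝ → ℝ} {u₁ m₁ u₂ m₂ : ℝ → ℝ → ℝ}

/-- Derivative in time of the duality pairing `∫ (u₁ - u₂) (m₁ - m₂)`. -/
theorem integral_duality_deriv (h₁ : IsMFGSolution T L σ r ε uT m0 u₁ m₁)
    (h₂ : IsMFGSolution T L σ r ε uT m0 u₂ m₂) (hdata : MFGData T L σ r ε uT m0) {t : ℝ}
    (ht : t ∈ Ioo 0 T) :
    ∫ x in (0:ℝ)..L, ((pdt u₁ t x - pdt u₂ t x) * (m₁ t x - m₂ t x)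
        + (u₁ t x - u₂ t x) * (pdt m₁ t x - pdt m₂ t x)) =
      r * (∫ x in (0:ℝ)..L, (u₁ t x - u₂ t x) * (m₁ t x - m₂ t x))
      + (∫ x in (0:ℝ)..L, (mfgG L ε u₁ m₁ t x - mfgG L ε u₂ m₂ t x) ^ 2 * (m₁ t x + m₂ t x))
      + ε * ((∫ x in (0:ℝ)..L, mfgG L ε u₁ m₁ t x * m₁ t x)
        - ∫ x in (0:ℝ)..L, mfgG L ε u₂ m₂ t x * m₂ t x) ^ 2 := by
  have hL := hdata.hL
  have htc : t ∈ Icc 0 T := ⟨ht.1.le, ht.2.le⟩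
  have a1 := continuous_slice h₁.u_smooth t
  have a2 := continuous_slice h₂.u_smooth t
  have b1 := continuous_slice h₁.m_smooth t
  have b2 := continuous_slice h₂.m_smooth t
  have at1 := continuous_slice (contDiff_pdt h₁.u_smooth) t
  have at2 := continuous_slice (contDiff_pdt h₂.u_smooth) t
  have bt1 := continuous_slice (contDiff_pdt h₁.m_smooth) t
  have bt2 := continuous_slice (contDiff_pdt h₂.m_smooth) t
  have ax1 := continuous_slice (contDiff_pdx h₁.u_smooth) t
  have ax2 := continuous_slice (contDiff_pdx h₂.u_smooth) t
  have bx1 := continuous_slice (contDiff_pdx h₁.m_smooth) t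
  have bx2 := continuous_slice (contDiff_pdx h₂.m_smooth) t
  have g1 := h₁.continuous_mfgG t
  have g2 := h₂.continuous_mfgG t
  have hμ : ∀ x, HasDerivAt (fun x => m₁ t x - m₂ t x) (pdx m₁ t x - pdx m₂ t x) x := fun x =>
    (hasDerivAt_pdx h₁.m_smooth t x).sub (hasDerivAt_pdx h₂.m_smooth t x)
  have hw : ∀ x, HasDerivAt (fun x => u₁ t x - u₂ t x) (pdx u₁ t x - pdx u₂ t x) x := fun x =>
    (hasDerivAt_pdx h₁.u_smooth t x).sub (hasDerivAt_pdx h₂.u_smooth t x)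
  have hμ0 : m₁ t 0 - m₂ t 0 = 0 := by rw [h₁.m_bdry t htc, h₂.m_bdry t htc, sub_zero]
  have hw0 : u₁ t 0 - u₂ t 0 = 0 := by rw [h₁.u_bdry t htc, h₂.u_bdry t htc, sub_zero]
  have I1 := h₁.integral_mul_pdt_u hL ht hμ (by fun_prop) hμ0
  have I2 := h₂.integral_mul_pdt_u hL ht hμ (by fun_prop) hμ0
  have J1 := h₁.integral_mul_pdt_m hL ht hw (by fun_prop) hw0
  have J2 := h₂.integral_mul_pdt_m hL ht hw (by fun_prop) hw0
  have hF := (h₁.mfgF_eq hdata htc).symm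
  have hF2 := (h₂.mfgF_eq hdata htc).symm
  set Q₁ := ∫ x in (0:ℝ)..L, mfgG L ε u₁ m₁ t x * m₁ t x with hQ₁
  set Q₂ := ∫ x in (0:ℝ)..L, mfgG L ε u₂ m₂ t x * m₂ t x with hQ₂
  calc _ = (∫ x in (0:ℝ)..L, (m₁ t x - m₂ t x) * pdt u₁ t x)
        - (∫ x in (0:ℝ)..L, (m₁ t x - m₂ t x) * pdt u₂ t x)
        + ((∫ x in (0:ℝ)..L, (u₁ t x - u₂ t x) * pdt m₁ t x)
        - ∫ x in (0:ℝ)..L, (u₁ t x - u₂ t x) * pdt m₂ t x) := by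
        rw [← intervalIntegral.integral_sub (by apply Continuous.intervalIntegrable; fun_prop)
            (by apply Continuous.intervalIntegrable; fun_prop),
          ← intervalIntegral.integral_sub (by apply Continuous.intervalIntegrable; fun_prop)
            (by apply Continuous.intervalIntegrable; fun_prop),
          ← intervalIntegral.integral_add (by apply Continuous.intervalIntegrable; fun_prop)
            (by apply Continuous.intervalIntegrable; fun_prop)]
        exact integral_congr fun x _ => by ring
    _ = (∫ x in (0:ℝ)..L, r * ((u₁ t x - u₂ t x) * (m₁ t x - m₂ t x)))
        + (∫ x in (0:ℝ)..L, (mfgG L ε u₁ m₁ t x - mfgG L ε u₂ m₂ t x) ^ 2 * (m₁ t x + m₂ t x))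
        - (mfgF L ε u₁ m₁ t - mfgF L ε u₂ m₂ t) * (Q₁ - Q₂) := by
        rw [I1, I2, J1, J2, hQ₁, hQ₂, neg_sub_neg,
          ← intervalIntegral.integral_sub (by apply Continuous.intervalIntegrable; fun_prop)
            (by apply Continuous.intervalIntegrable; fun_prop),
          ← intervalIntegral.integral_sub (by apply Continuous.intervalIntegrable; fun_prop)
            (by apply Continuous.intervalIntegrable; fun_prop),
          ← intervalIntegral.integral_add (by apply Continuous.intervalIntegrable; fun_prop)
            (by apply Continuous.intervalIntegrable; fun_prop),
          ← intervalIntegral.integral_add (by apply Continuous.intervalIntegrable; fun_prop)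
            (by apply Continuous.intervalIntegrable; fun_prop),
          ← intervalIntegral.integral_sub (a := 0) (b := L)
            (f := fun x => mfgG L ε u₁ m₁ t x * m₁ t x)
            (by apply Continuous.intervalIntegrable; fun_prop)
            (by apply Continuous.intervalIntegrable; fun_prop),
          ← intervalIntegral.integral_const_mul,
          ← intervalIntegral.integral_sub (by apply Continuous.intervalIntegrable; fun_prop)
            (by apply Continuous.intervalIntegrable; fun_prop)]
        refine integral_congr fun x _ => ?_
        simp only [mfgG]
        ring
    _ = _ := by
        rw [intervalIntegral.integral_const_mul, ← hF, ← hF2]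
        ring

/-- The nonlocal terms of two solutions coincide. -/
theorem mfgF_unique (h₁ : IsMFGSolution T L σ r ε uT m0 u₁ m₁)
    (h₂ : IsMFGSolution T L σ r ε uT m0 u₂ m₂) (hdata : MFGData T L σ r ε uT m0) :
    ∀ t ∈ Ioo 0 T, mfgF L ε u₁ m₁ t = mfgF L ε u₂ m₂ t := by
  have hL := hdata.hL
  have a1 := h₁.u_smooth.continuous
  have a2 := h₂.u_smooth.continuous
  have b1 := h₁.m_smooth.continuous
  have b2 := h₂.m_smooth.continuous
  have at1 := (contDiff_pdt h₁.u_smooth).continuous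
  have at2 := (contDiff_pdt h₂.u_smooth).continuous
  have bt1 := (contDiff_pdt h₁.m_smooth).continuous
  have bt2 := (contDiff_pdt h₂.m_smooth).continuous
  let P : ℝ → ℝ := fun t => ∫ x in (0:ℝ)..L, (u₁ t x - u₂ t x) * (m₁ t x - m₂ t x)
  let P' : ℝ → ℝ := fun t => ∫ x in (0:ℝ)..L, ((pdt u₁ t x - pdt u₂ t x) * (m₁ t x - m₂ t x)
        + (u₁ t x - u₂ t x) * (pdt m₁ t x - pdt m₂ t x))
  have hP : ∀ t, HasDerivAt P (P' t) t := by
    refine hasDerivAt_intervalIntegral_param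
      (F := fun t x => (u₁ t x - u₂ t x) * (m₁ t x - m₂ t x))
      (F' := fun t x => (pdt u₁ t x - pdt u₂ t x) * (m₁ t x - m₂ t x)
        + (u₁ t x - u₂ t x) * (pdt m₁ t x - pdt m₂ t x)) 0 L (fun t => ?_) ?_ fun t x => ?_
    · have a1 := continuous_slice h₁.u_smooth t
      have a2 := continuous_slice h₂.u_smooth t
      have b1 := continuous_slice h₁.m_smooth t
      have b2 := continuous_slice h₂.m_smooth t
      fun_prop
    · change Continuous fun p : ℝ × ℝ =>
        (uncurry (pdt u₁) p - uncurry (pdt u₂) p) * (uncurry m₁ p - uncurry m₂ p)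
        + (uncurry u₁ p - uncurry u₂ p) * (uncurry (pdt m₁) p - uncurry (pdt m₂) p)
      fun_prop
    · exact ((hasDerivAt_pdt h₁.u_smooth t x).sub (hasDerivAt_pdt h₂.u_smooth t x)).mul
        ((hasDerivAt_pdt h₁.m_smooth t x).sub (hasDerivAt_pdt h₂.m_smooth t x))
  have hP0 : P 0 = 0 := by
    refine (integral_congr (g := fun _ => 0) fun x hx => ?_).trans (by simp)
    rw [uIcc_of_le hL.le] at hx
    simp [h₁.m_init x hx, h₂.m_init x hx]
  have hPT : P T = 0 := by
    refine (integral_congr (g := fun _ => 0) fun x hx => ?_).trans (by simp)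
    rw [uIcc_of_le hL.le] at hx
    simp [h₁.u_term x hx, h₂.u_term x hx]
  let A : ℝ → ℝ := fun t => ∫ x in (0:ℝ)..L,
    (mfgG L ε u₁ m₁ t x - mfgG L ε u₂ m₂ t x) ^ 2 * (m₁ t x + m₂ t x)
  let B : ℝ → ℝ := fun t => (∫ x in (0:ℝ)..L, mfgG L ε u₁ m₁ t x * m₁ t x)
    - ∫ x in (0:ℝ)..L, mfgG L ε u₂ m₂ t x * m₂ t x
  have hA : ∀ t ∈ Icc 0 T, 0 ≤ A t := fun t ht => integral_nonneg hL.le fun x hx =>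
    mul_nonneg (sq_nonneg _)
      (add_nonneg (h₁.m_nonneg hdata t ht x hx) (h₂.m_nonneg hdata t ht x hx))
  have hB : ∀ t, 0 ≤ ε * B t ^ 2 := fun t => mul_nonneg hdata.hε (sq_nonneg _)
  have hP' : ∀ t ∈ Ioo 0 T, P' t = r * P t + A t + ε * B t ^ 2 := fun t ht =>
    h₁.integral_duality_deriv h₂ hdata ht
  have hE : ∀ t, HasDerivAt (fun t => Real.exp (-r * t) * P t)
      (Real.exp (-r * t) * (P' t - r * P t)) t := fun t => by
    have h1 : HasDerivAt (fun s => Real.exp (-r * s)) (Real.exp (-r * t) * (-r * 1)) t :=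
      ((hasDerivAt_id t).const_mul (-r)).exp
    exact (h1.mul (hP t)).congr_deriv (by ring)
  have hmono := monotoneOn_of_deriv_nonneg (convex_Icc 0 T)
    (f := fun t => Real.exp (-r * t) * P t)
    (fun t _ => (hE t).continuousAt.continuousWithinAt)
    (fun t _ => (hE t).differentiableAt.differentiableWithinAt)
    (fun t ht => by
      rw [interior_Icc] at ht
      rw [(hE t).deriv, hP' t ht]
      exact mul_nonneg (Real.exp_pos _).le
        (by linarith [hA t ⟨ht.1.le, ht.2.le⟩, hB t]))
  have hE0 : ∀ t ∈ Icc 0 T, Real.exp (-r * t) * P t = 0 := fun t ht => by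
    have l := hmono ⟨le_rfl, hdata.hT.le⟩ ht ht.1
    have u := hmono ht ⟨hdata.hT.le, le_rfl⟩ ht.2
    simp only [hP0, hPT, mul_zero] at l u
    exact le_antisymm u l
  intro t ht
  have htc : t ∈ Icc 0 T := ⟨ht.1.le, ht.2.le⟩
  have hder : Real.exp (-r * t) * (P' t - r * P t) = 0 := by
    refine (hE t).unique ((hasDerivAt_const t (0:ℝ)).congr_of_eventuallyEq ?_)
    filter_upwards [Icc_mem_nhds ht.1 ht.2] with s hs using hE0 s hs
  have hsum : A t + ε * B t ^ 2 = 0 := by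
    have := (mul_eq_zero.1 hder).resolve_left (Real.exp_pos _).ne'
    rw [hP' t ht] at this
    linarith
  have hεB : ε * B t ^ 2 = 0 := le_antisymm (by linarith [hA t htc]) (hB t)
  have hεB' : ε * B t = 0 := by
    rcases mul_eq_zero.1 hεB with h | h
    · rw [h, zero_mul]
    · rw [pow_eq_zero_iff two_ne_zero |>.1 h, mul_zero]
  rw [h₁.mfgF_eq hdata htc, h₂.mfgF_eq hdata htc]
  simp only [B] at hεB'
  linarith

/-- Uniqueness of the value function. -/
theorem u_unique (h₁ : IsMFGSolution T L σ r ε uT m0 u₁ m₁)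
    (h₂ : IsMFGSolution T L σ r ε uT m0 u₂ m₂) (hdata : MFGData T L σ r ε uT m0) :
    ∀ t ∈ Icc 0 T, ∀ x ∈ Icc 0 L, u₁ t x = u₂ t x := by
  have hL := hdata.hL
  have hσ := hdata.hσ
  obtain ⟨K₁, hK₁⟩ := h₁.exists_mfgG_sq_le hL
  obtain ⟨K₂, hK₂⟩ := h₂.exists_mfgG_sq_le hL
  have a1 := h₁.u_smooth.continuous
  have a2 := h₂.u_smooth.continuous
  have at1 := (contDiff_pdt h₁.u_smooth).continuous
  have at2 := (contDiff_pdt h₂.u_smooth).continuous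
  have hW : ∀ t, HasDerivAt (fun t => ∫ x in (0:ℝ)..L, (u₁ t x - u₂ t x) ^ 2)
      (∫ x in (0:ℝ)..L, 2 * ((u₁ t x - u₂ t x) * (pdt u₁ t x - pdt u₂ t x))) t := by
    refine hasDerivAt_intervalIntegral_param
      (F := fun t x => (u₁ t x - u₂ t x) ^ 2)
      (F' := fun t x => 2 * ((u₁ t x - u₂ t x) * (pdt u₁ t x - pdt u₂ t x)))
      0 L (fun t => ?_) ?_ fun t x => ?_
    · have a1 := continuous_slice h₁.u_smooth t
      have a2 := continuous_slice h₂.u_smooth t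
      fun_prop
    · change Continuous fun p : ℝ × ℝ =>
        2 * ((uncurry u₁ p - uncurry u₂ p) * (uncurry (pdt u₁) p - uncurry (pdt u₂) p))
      fun_prop
    · exact (((hasDerivAt_pdt h₁.u_smooth t x).sub
        (hasDerivAt_pdt h₂.u_smooth t x)).pow 2).congr_deriv (by simp; ring)
  have hWT : ∫ x in (0:ℝ)..L, (u₁ T x - u₂ T x) ^ 2 = 0 := by
    refine (integral_congr (g := fun _ => 0) fun x hx => ?_).trans (by simp)
    rw [uIcc_of_le hL.le] at hx
    simp [h₁.u_term x hx, h₂.u_term x hx]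
  have hz := eqOn_zero_of_neg_mul_le_deriv (T := T) (K := (K₁ + K₂) / (2 * σ^2)) hW
    (fun t => integral_nonneg hL.le fun x _ => sq_nonneg _) hWT (fun t ht => by
      have htc : t ∈ Icc 0 T := ⟨ht.1.le, ht.2.le⟩
      have a1 := continuous_slice h₁.u_smooth t
      have a2 := continuous_slice h₂.u_smooth t
      have at1 := continuous_slice (contDiff_pdt h₁.u_smooth) t
      have at2 := continuous_slice (contDiff_pdt h₂.u_smooth) t
      have ax1 := continuous_slice (contDiff_pdx h₁.u_smooth) t
      have ax2 := continuous_slice (contDiff_pdx h₂.u_smooth) t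
      have g1 := h₁.continuous_mfgG t
      have g2 := h₂.continuous_mfgG t
      have hw : ∀ x, HasDerivAt (fun x => u₁ t x - u₂ t x) (pdx u₁ t x - pdx u₂ t x) x :=
        fun x => (hasDerivAt_pdx h₁.u_smooth t x).sub (hasDerivAt_pdx h₂.u_smooth t x)
      have hw0 : u₁ t 0 - u₂ t 0 = 0 := by rw [h₁.u_bdry t htc, h₂.u_bdry t htc, sub_zero]
      have I1 := h₁.integral_mul_pdt_u hL ht hw (by fun_prop) hw0
      have I2 := h₂.integral_mul_pdt_u hL ht hw (by fun_prop) hw0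
      simp only [mul_sub (u₁ t _ - u₂ t _) (pdt u₁ t _)]
      rw [intervalIntegral.integral_const_mul,
        intervalIntegral.integral_sub (by apply Continuous.intervalIntegrable; fun_prop)
          (by apply Continuous.intervalIntegrable; fun_prop), I1, I2,
        ← intervalIntegral.integral_sub (by apply Continuous.intervalIntegrable; fun_prop)
          (by apply Continuous.intervalIntegrable; fun_prop),
        ← intervalIntegral.integral_const_mul, ← intervalIntegral.integral_const_mul,
        ← intervalIntegral.integral_neg]
      refine integral_mono_on hL.le (by apply Continuous.intervalIntegrable; fun_prop)
        (by apply Continuous.intervalIntegrable; fun_prop) fun x hx => ?_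
      have k1 := hK₁ t ht x hx
      have k2 := hK₂ t ht x hx
      have hG : mfgG L ε u₁ m₁ t x - mfgG L ε u₂ m₂ t x
          = -(1/2) * (pdx u₁ t x - pdx u₂ t x) := by
        simp only [mfgG, h₁.mfgF_unique h₂ hdata t ht]
        ring
      set w := u₁ t x - u₂ t x with hw_def
      set y := pdx u₁ t x - pdx u₂ t x with hy
      set S := mfgG L ε u₁ m₁ t x + mfgG L ε u₂ m₂ t x with hS
      have hS2 : (S / 2) ^ 2 ≤ (K₁ + K₂) / 2 := by
        nlinarith [sq_nonneg (mfgG L ε u₁ m₁ t x - mfgG L ε u₂ m₂ t x)]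
      have h1 := neg_mul_flux_le hσ hS2 y w
      have h2 : σ^2/2 * (y * pdx u₁ t x) + w * (r * u₁ t x - mfgG L ε u₁ m₁ t x ^ 2)
          - (σ^2/2 * (y * pdx u₂ t x) + w * (r * u₂ t x - mfgG L ε u₂ m₂ t x ^ 2))
          = y * (σ^2/2 * y + S / 2 * w) + r * w ^ 2 := by
        have e : mfgG L ε u₁ m₁ t x ^ 2 - mfgG L ε u₂ m₂ t x ^ 2 = -(1/2) * y * S := by
          rw [← hG, hS]; ring
        rw [hy, hw_def]
        linear_combination -w * e
      rw [h2]
      have h3 : (K₁ + K₂) / (2 * σ^2) * w ^ 2 = 2 * ((K₁ + K₂) / 2 / (2 * σ^2) * w ^ 2) := by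
        ring
      have h4 := mul_nonneg hdata.hr.le (sq_nonneg w)
      linarith)
  intro t ht x hx
  have a1 := continuous_slice h₁.u_smooth t
  have a2 := continuous_slice h₂.u_smooth t
  have := eq_zero_of_intervalIntegral_eq_zero hL (by fun_prop) (fun x => sq_nonneg _) (hz t ht) x hx
  exact sub_eq_zero.1 (pow_eq_zero_iff two_ne_zero |>.1 this)

theorem mfgG_unique (h₁ : IsMFGSolution T L σ r ε uT m0 u₁ m₁)
    (h₂ : IsMFGSolution T L σ r ε uT m0 u₂ m₂) (hdata : MFGData T L σ r ε uT m0) :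
    ∀ t ∈ Ioo 0 T, ∀ x ∈ Icc 0 L, mfgG L ε u₁ m₁ t x = mfgG L ε u₂ m₂ t x := by
  intro t ht
  refine eq_on_Icc_of_eq_on_Ioo hdata.hL (h₁.continuous_mfgG t) (h₂.continuous_mfgG t)
    fun x hx => ?_
  have : pdx u₁ t x = pdx u₂ t x := by
    refine Filter.EventuallyEq.deriv_eq ?_
    filter_upwards [Icc_mem_nhds hx.1 hx.2] with y hy using
      h₁.u_unique h₂ hdata t ⟨ht.1.le, ht.2.le⟩ y hy
  rw [mfgG, mfgG, this, h₁.mfgF_unique h₂ hdata t ht]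

/-- Uniqueness of the density. -/
theorem m_unique (h₁ : IsMFGSolution T L σ r ε uT m0 u₁ m₁)
    (h₂ : IsMFGSolution T L σ r ε uT m0 u₂ m₂) (hdata : MFGData T L σ r ε uT m0) :
    ∀ t ∈ Icc 0 T, ∀ x ∈ Icc 0 L, m₁ t x = m₂ t x := by
  have hL := hdata.hL
  have hσ := hdata.hσ
  obtain ⟨K, hK⟩ := h₁.exists_mfgG_sq_le hL
  have a1 := h₁.m_smooth.continuous
  have a2 := h₂.m_smooth.continuous
  have at1 := (contDiff_pdt h₁.m_smooth).continuous
  have at2 := (contDiff_pdt h₂.m_smooth).continuous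
  have hW : ∀ t, HasDerivAt (fun t => ∫ x in (0:ℝ)..L, (m₁ t x - m₂ t x) ^ 2)
      (∫ x in (0:ℝ)..L, 2 * ((m₁ t x - m₂ t x) * (pdt m₁ t x - pdt m₂ t x))) t := by
    refine hasDerivAt_intervalIntegral_param
      (F := fun t x => (m₁ t x - m₂ t x) ^ 2)
      (F' := fun t x => 2 * ((m₁ t x - m₂ t x) * (pdt m₁ t x - pdt m₂ t x)))
      0 L (fun t => ?_) ?_ fun t x => ?_
    · have a1 := continuous_slice h₁.m_smooth t
      have a2 := continuous_slice h₂.m_smooth t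
      fun_prop
    · change Continuous fun p : ℝ × ℝ =>
        2 * ((uncurry m₁ p - uncurry m₂ p) * (uncurry (pdt m₁) p - uncurry (pdt m₂) p))
      fun_prop
    · exact (((hasDerivAt_pdt h₁.m_smooth t x).sub
        (hasDerivAt_pdt h₂.m_smooth t x)).pow 2).congr_deriv (by simp; ring)
  have hW0 : ∫ x in (0:ℝ)..L, (m₁ 0 x - m₂ 0 x) ^ 2 = 0 := by
    refine (integral_congr (g := fun _ => 0) fun x hx => ?_).trans (by simp)
    rw [uIcc_of_le hL.le] at hx
    simp [h₁.m_init x hx, h₂.m_init x hx]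
  have hz := eqOn_zero_of_deriv_le_mul (T := T) (K := 2 * (K / (2 * σ^2))) hW
    (fun t => integral_nonneg hL.le fun x _ => sq_nonneg _) hW0 (fun t ht => by
      have htc : t ∈ Icc 0 T := ⟨ht.1.le, ht.2.le⟩
      have a1 := continuous_slice h₁.m_smooth t
      have a2 := continuous_slice h₂.m_smooth t
      have at1 := continuous_slice (contDiff_pdt h₁.m_smooth) t
      have at2 := continuous_slice (contDiff_pdt h₂.m_smooth) t
      have ax1 := continuous_slice (contDiff_pdx h₁.m_smooth) t
      have ax2 := continuous_slice (contDiff_pdx h₂.m_smooth) t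
      have g1 := h₁.continuous_mfgG t
      have g2 := h₂.continuous_mfgG t
      have hw : ∀ x, HasDerivAt (fun x => m₁ t x - m₂ t x) (pdx m₁ t x - pdx m₂ t x) x :=
        fun x => (hasDerivAt_pdx h₁.m_smooth t x).sub (hasDerivAt_pdx h₂.m_smooth t x)
      have hw0 : m₁ t 0 - m₂ t 0 = 0 := by rw [h₁.m_bdry t htc, h₂.m_bdry t htc, sub_zero]
      have I1 := h₁.integral_mul_pdt_m hL ht hw (by fun_prop) hw0
      have I2 := h₂.integral_mul_pdt_m hL ht hw (by fun_prop) hw0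
      simp only [mul_sub (m₁ t _ - m₂ t _) (pdt m₁ t _)]
      rw [intervalIntegral.integral_const_mul,
        intervalIntegral.integral_sub (by apply Continuous.intervalIntegrable; fun_prop)
          (by apply Continuous.intervalIntegrable; fun_prop), I1, I2, neg_sub_neg,
        ← intervalIntegral.integral_sub (by apply Continuous.intervalIntegrable; fun_prop)
          (by apply Continuous.intervalIntegrable; fun_prop),
        ← intervalIntegral.integral_const_mul, ← intervalIntegral.integral_const_mul]
      refine integral_mono_on hL.le (by apply Continuous.intervalIntegrable; fun_prop)
        (by apply Continuous.intervalIntegrable; fun_prop) fun x hx => ?_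
      have h1 := neg_mul_flux_le hσ (hK t ht x hx) (pdx m₁ t x - pdx m₂ t x) (m₁ t x - m₂ t x)
      rw [← h₁.mfgG_unique h₂ hdata t ht x hx]
      linarith)
  intro t ht x hx
  have a1 := continuous_slice h₁.m_smooth t
  have a2 := continuous_slice h₂.m_smooth t
  have := eq_zero_of_intervalIntegral_eq_zero hL (by fun_prop) (fun x => sq_nonneg _) (hz t ht) x hx
  exact sub_eq_zero.1 (pow_eq_zero_iff two_ne_zero |>.1 this)

end IsMFGSolution

section Regularity

variable {T L : ℝ} {u v : ℝ → ℝ → ℝ}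

theorem eqOn_rectangle_of_eqOn_interior (hT : 0 < T) (hL : 0 < L)
    (hu : Continuous (uncurry u)) (hv : Continuous (uncurry v))
    (h : ∀ t ∈ Ioo 0 T, ∀ x ∈ Ioo 0 L, u t x = v t x) :
    ∀ t ∈ Icc 0 T, ∀ x ∈ Icc 0 L, u t x = v t x := by
  have h1 : EqOn (uncurry u) (uncurry v) (Ioo 0 T ×ˢ Ioo 0 L) := fun p hp =>
    h p.1 hp.1 p.2 hp.2
  have h2 := h1.closure hu hv
  rw [closure_prod_eq, closure_Ioo hT.ne, closure_Ioo hL.ne] at h2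
  exact fun t ht x hx => h2 (x := (t, x)) ⟨ht, hx⟩

theorem pdx_congr_rectangle (hT : 0 < T) (hL : 0 < L)
    (hu : ContDiff ℝ (⊤ : ℕ∞) (uncurry u)) (hv : ContDiff ℝ (⊤ : ℕ∞) (uncurry v))
    (h : ∀ t ∈ Icc 0 T, ∀ x ∈ Icc 0 L, u t x = v t x) :
    ∀ t ∈ Icc 0 T, ∀ x ∈ Icc 0 L, pdx u t x = pdx v t x := by
  refine eqOn_rectangle_of_eqOn_interior hT hL (contDiff_pdx hu).continuous
    (contDiff_pdx hv).continuous fun t ht x hx => Filter.EventuallyEq.deriv_eq ?_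
  filter_upwards [Icc_mem_nhds hx.1 hx.2] with y hy using h t ⟨ht.1.le, ht.2.le⟩ y hy

theorem pdt_congr_rectangle (hT : 0 < T) (hL : 0 < L)
    (hu : ContDiff ℝ (⊤ : ℕ∞) (uncurry u)) (hv : ContDiff ℝ (⊤ : ℕ∞) (uncurry v))
    (h : ∀ t ∈ Icc 0 T, ∀ x ∈ Icc 0 L, u t x = v t x) :
    ∀ t ∈ Icc 0 T, ∀ x ∈ Icc 0 L, pdt u t x = pdt v t x := by
  refine eqOn_rectangle_of_eqOn_interior hT hL (contDiff_pdt hu).continuous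
    (contDiff_pdt hv).continuous fun t ht x hx => Filter.EventuallyEq.deriv_eq ?_
  filter_upwards [Icc_mem_nhds ht.1 ht.2] with s hs using h s hs x ⟨hx.1.le, hx.2.le⟩

theorem pdxx_congr_rectangle (hT : 0 < T) (hL : 0 < L)
    (hu : ContDiff ℝ (⊤ : ℕ∞) (uncurry u)) (hv : ContDiff ℝ (⊤ : ℕ∞) (uncurry v))
    (h : ∀ t ∈ Icc 0 T, ∀ x ∈ Icc 0 L, u t x = v t x) :
    ∀ t ∈ Icc 0 T, ∀ x ∈ Icc 0 L, pdxx u t x = pdxx v t x :=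
  pdx_congr_rectangle hT hL (contDiff_pdx hu) (contDiff_pdx hv)
    (pdx_congr_rectangle hT hL hu hv h)

theorem exists_abs_le_rectangle (T L : ℝ) (hu : ContDiff ℝ (⊤ : ℕ∞) (uncurry u)) :
    ∃ C, 0 ≤ C ∧ ∀ t ∈ Icc 0 T, ∀ x ∈ Icc 0 L, |u t x| ≤ C := by
  obtain ⟨C, hC⟩ := ((isCompact_Icc (a := (0:ℝ)) (b := T)).prod
    (isCompact_Icc (a := 0) (b := L))).exists_bound_of_continuousOn hu.continuous.continuousOn
  exact ⟨max C 0, le_max_right _ _, fun t ht x hx =>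
    (hC (t, x) ⟨ht, hx⟩).trans (le_max_left _ _)⟩

theorem le_rpow_mul_rpow {a A β : ℝ} (ha : 0 ≤ a) (haA : a ≤ A) (hβ : 0 < β) (hβ1 : β ≤ 1) :
    a ≤ A ^ (1 - β) * a ^ β := by
  rcases ha.eq_or_lt with rfl | hpos
  · simp [Real.zero_rpow hβ.ne']
  · calc a = a ^ (1 - β) * a ^ β := by rw [← Real.rpow_add hpos]; simp
      _ ≤ A ^ (1 - β) * a ^ β := by
        gcongr

/-- A smooth function is parabolic Hölder continuous on a rectangle. -/
theorem exists_parabolic_holder (T L : ℝ) {α : ℝ} (hα : α ∈ Ioo (0:ℝ) 1)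
    (hu : ContDiff ℝ (⊤ : ℕ∞) (uncurry u)) :
    ∃ C, 0 ≤ C ∧ ∀ t ∈ Icc 0 T, ∀ x ∈ Icc 0 L, ∀ s ∈ Icc 0 T, ∀ y ∈ Icc 0 L,
      |u t x - u s y| ≤ C * (|t - s| ^ (α/2) + |x - y| ^ α) := by
  obtain ⟨K, hK⟩ := ContDiffOn.exists_lipschitzOnWith hu.contDiffOn (by simp)
    ((convex_Icc 0 T).prod (convex_Icc 0 L)) (isCompact_Icc.prod isCompact_Icc)
  refine ⟨K * max (|T| ^ (1 - α/2)) (|L| ^ (1 - α)), by positivity,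
    fun t ht x hx s hs y hy => ?_⟩
  have h1 := hK.dist_le_mul (t, x) ⟨ht, hx⟩ (s, y) ⟨hs, hy⟩
  rw [Prod.dist_eq, Real.dist_eq, Real.dist_eq, Real.dist_eq] at h1
  have ht' : |t - s| ≤ |T| := by
    rw [abs_of_nonneg (ht.1.trans ht.2), abs_le]
    constructor <;> linarith [ht.1, ht.2, hs.1, hs.2]
  have hx' : |x - y| ≤ |L| := by
    rw [abs_of_nonneg (hx.1.trans hx.2), abs_le]
    constructor <;> linarith [hx.1, hx.2, hy.1, hy.2]
  have h2 := le_rpow_mul_rpow (abs_nonneg (t - s)) ht' (half_pos hα.1) (by linarith [hα.2])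
  have h3 := le_rpow_mul_rpow (abs_nonneg (x - y)) hx' hα.1 hα.2.le
  calc |u t x - u s y| ≤ K * max |t - s| |x - y| := h1
    _ ≤ K * (|t - s| + |x - y|) := by
      gcongr
      exact max_le_add_of_nonneg (abs_nonneg _) (abs_nonneg _)
    _ ≤ K * (max (|T| ^ (1 - α/2)) (|L| ^ (1 - α)) * |t - s| ^ (α/2)
        + max (|T| ^ (1 - α/2)) (|L| ^ (1 - α)) * |x - y| ^ α) := by
      gcongr
      · exact h2.trans (by gcongr; exact le_max_left _ _)
      · exact h3.trans (by gcongr; exact le_max_right _ _)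
    _ = _ := by ring

/-- A single smooth pair satisfies the parabolic Hölder bounds on a rectangle. -/
theorem exists_holder_bound_of_contDiff (T L : ℝ) {α : ℝ} (hα : α ∈ Ioo (0:ℝ) 1)
    (hu : ContDiff ℝ (⊤ : ℕ∞) (uncurry u)) (hv : ContDiff ℝ (⊤ : ℕ∞) (uncurry v)) :
    ∃ C : ℝ, 0 < C ∧
      (∀ t ∈ Icc 0 T, ∀ x ∈ Icc 0 L,
        |u t x| ≤ C ∧ |pdt u t x| ≤ C ∧ |pdx u t x| ≤ C ∧ |pdxx u t x| ≤ C ∧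
        |v t x| ≤ C ∧ |pdt v t x| ≤ C ∧ |pdx v t x| ≤ C ∧ |pdxx v t x| ≤ C) ∧
      (∀ t ∈ Icc 0 T, ∀ x ∈ Icc 0 L, ∀ s ∈ Icc 0 T, ∀ y ∈ Icc 0 L,
        |pdt u t x - pdt u s y| + |pdxx u t x - pdxx u s y|
          + |pdt v t x - pdt v s y| + |pdxx v t x - pdxx v s y|
        ≤ C * (|t - s| ^ (α/2) + |x - y| ^ α)) := by
  obtain ⟨c₁, p₁, h₁⟩ := exists_abs_le_rectangle T L hu
  obtain ⟨c₂, p₂, h₂⟩ := exists_abs_le_rectangle T L (contDiff_pdt hu)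
  obtain ⟨c₃, p₃, h₃⟩ := exists_abs_le_rectangle T L (contDiff_pdx hu)
  obtain ⟨c₄, p₄, h₄⟩ := exists_abs_le_rectangle T L (contDiff_pdxx hu)
  obtain ⟨c₅, p₅, h₅⟩ := exists_abs_le_rectangle T L hv
  obtain ⟨c₆, p₆, h₆⟩ := exists_abs_le_rectangle T L (contDiff_pdt hv)
  obtain ⟨c₇, p₇, h₇⟩ := exists_abs_le_rectangle T L (contDiff_pdx hv)
  obtain ⟨c₈, p₈, h₈⟩ := exists_abs_le_rectangle T L (contDiff_pdxx hv)
  obtain ⟨d₁, q₁, k₁⟩ := exists_parabolic_holder T L hα (contDiff_pdt hu)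
  obtain ⟨d₂, q₂, k₂⟩ := exists_parabolic_holder T L hα (contDiff_pdxx hu)
  obtain ⟨d₃, q₃, k₃⟩ := exists_parabolic_holder T L hα (contDiff_pdt hv)
  obtain ⟨d₄, q₄, k₄⟩ := exists_parabolic_holder T L hα (contDiff_pdxx hv)
  refine ⟨c₁ + c₂ + c₃ + c₄ + c₅ + c₆ + c₇ + c₈ + d₁ + d₂ + d₃ + d₄ + 1, by positivity,
    fun t ht x hx => ?_, fun t ht x hx s hs y hy => ?_⟩
  · have := h₁ t ht x hx
    have := h₂ t ht x hx
    have := h₃ t ht x hx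
    have := h₄ t ht x hx
    have := h₅ t ht x hx
    have := h₆ t ht x hx
    have := h₇ t ht x hx
    have := h₈ t ht x hx
    refine ⟨?_, ?_, ?_, ?_, ?_, ?_, ?_, ?_⟩ <;> linarith
  · have e₁ := k₁ t ht x hx s hs y hy
    have e₂ := k₂ t ht x hx s hs y hy
    have e₃ := k₃ t ht x hx s hs y hy
    have e₄ := k₄ t ht x hx s hs y hy
    have hD : 0 ≤ |t - s| ^ (α/2) + |x - y| ^ α := by positivity
    have hsum : d₁ + d₂ + d₃ + d₄
        ≤ c₁ + c₂ + c₃ + c₄ + c₅ + c₆ + c₇ + c₈ + d₁ + d₂ + d₃ + d₄ + 1 := by linarith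
    have := mul_le_mul_of_nonneg_right hsum hD
    linarith

end Regularity

/-- full parabolic Hölder regularity: the C^{1+α/2,2+α} norms of u and m
are bounded by a constant depending only on the data. -/
theorem mfg_holder_regularity (T L σ r ε : ℝ) (uT m0 : ℝ → ℝ)
    (hdata : MFGData T L σ r ε uT m0) :
    ∃ α C : ℝ, α ∈ Ioo (0:ℝ) 1 ∧ 0 < C ∧
      ∀ u m : ℝ → ℝ → ℝ, IsMFGSolution T L σ r ε uT m0 u m →
        (∀ t ∈ Icc (0:ℝ) T, ∀ x ∈ Icc (0:ℝ) L,
          |u t x| ≤ C ∧ |pdt u t x| ≤ C ∧ |pdx u t x| ≤ C ∧ |pdxx u t x| ≤ C ∧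
          |m t x| ≤ C ∧ |pdt m t x| ≤ C ∧ |pdx m t x| ≤ C ∧ |pdxx m t x| ≤ C) ∧
        (∀ t ∈ Icc (0:ℝ) T, ∀ x ∈ Icc (0:ℝ) L, ∀ s ∈ Icc (0:ℝ) T, ∀ y ∈ Icc (0:ℝ) L,
          |pdt u t x - pdt u s y| + |pdxx u t x - pdxx u s y|
            + |pdt m t x - pdt m s y| + |pdxx m t x - pdxx m s y|
          ≤ C * (|t - s| ^ (α/2) + |x - y| ^ α)) := by
  by_cases hex : ∃ u₀ m₀, IsMFGSolution T L σ r ε uT m0 u₀ m₀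
  · obtain ⟨u₀, m₀, h₀⟩ := hex
    have hα : (1/2 : ℝ) ∈ Ioo (0:ℝ) 1 := by norm_num
    obtain ⟨C, hC, hbound, hholder⟩ :=
      exists_holder_bound_of_contDiff T L hα h₀.u_smooth h₀.m_smooth
    refine ⟨1/2, C, hα, hC, fun u m h => ?_⟩
    have hT := hdata.hT
    have hL := hdata.hL
    have eu := h.u_unique h₀ hdata
    have em := h.m_unique h₀ hdata
    have eut := pdt_congr_rectangle hT hL h.u_smooth h₀.u_smooth eu
    have eux := pdx_congr_rectangle hT hL h.u_smooth h₀.u_smooth eu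
    have euxx := pdxx_congr_rectangle hT hL h.u_smooth h₀.u_smooth eu
    have emt := pdt_congr_rectangle hT hL h.m_smooth h₀.m_smooth em
    have emx := pdx_congr_rectangle hT hL h.m_smooth h₀.m_smooth em
    have emxx := pdxx_congr_rectangle hT hL h.m_smooth h₀.m_smooth em
    constructor
    · intro t ht x hx
      rw [eu t ht x hx, em t ht x hx, eut t ht x hx, eux t ht x hx, euxx t ht x hx,
        emt t ht x hx, emx t ht x hx, emxx t ht x hx]
      exact hbound t ht x hx
    · intro t ht x hx s hs y hy
      rw [eut t ht x hx, euxx t ht x hx, emt t ht x hx, emxx t ht x hx,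
        eut s hs y hy, euxx s hs y hy, emt s hs y hy, emxx s hs y hy]
      exact hholder t ht x hx s hs y hy
  · exact ⟨1/2, 1, by norm_num, one_pos, fun u m h => absurd ⟨u, m, h⟩ hex⟩
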